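/- Suppose the quadratic form x ↦ ⟨x, T x⟩ is a Legendre form, c_i = 0 for every index i with T_i ≠ 0, the constraint set F is nonempty, and f is bounded from below on F. Then f attains its infimum on F. -/

import Mathlib

open scoped RealInnerProductSpace
open Filter Topology

/-- A sequence `x` in a real inner product space converges weakly to `x₀` if
`⟪a, x k⟫ → ⟪a, x₀⟫` for every `a`. -/
def WeaklyConvergesTo {H : Type*} [NormedAddCommGroup H] [InnerProductSpace ℝ H]
    (x : ℕ → H) (x₀ : H) : Prop :=
  ∀ a : H, Tendsto (fun k => ⟪a, x k⟫) atTop (𝓝 ⟪a, x₀⟫)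

/-- The quadratic form `x ↦ ⟪x, T x⟫` is a Legendre form: it is weakly sequentially lower
semicontinuous, and `x k → x₀` strongly whenever `x k ⇀ x₀` and `⟪x k, T (x k)⟫ → ⟪x₀, T x₀⟫`. -/
def IsLegendreForm {H : Type*} [NormedAddCommGroup H] [InnerProductSpace ℝ H]
    (T : H →L[ℝ] H) : Prop :=
  (∀ (x : ℕ → H) (x₀ : H), WeaklyConvergesTo x x₀ →
      ⟪x₀, T x₀⟫ ≤ Filter.liminf (fun k => ⟪x k, T (x k)⟫) Filter.atTop) ∧
  (∀ (x : ℕ → H) (x₀ : H), WeaklyConvergesTo x x₀ →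
      Tendsto (fun k => ⟪x k, T (x k)⟫) atTop (𝓝 ⟪x₀, T x₀⟫) →
      Tendsto x atTop (𝓝 x₀))

open Set in
theorem exists_subseq_weaklyConvergesTo {H : Type*} [NormedAddCommGroup H]
    [InnerProductSpace ℝ H] [CompleteSpace H] {x : ℕ → H} {M : ℝ} (hx : ∀ n, ‖x n‖ ≤ M) :
    ∃ (x₀ : H) (φ : ℕ → ℕ), StrictMono φ ∧ WeaklyConvergesTo (x ∘ φ) x₀ := by
  let S : Submodule ℝ H := (Submodule.span ℝ (range x)).topologicalClosure
  have hxS : ∀ n, x n ∈ S := fun n =>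
    Submodule.le_topologicalClosure _ (Submodule.subset_span (mem_range_self n))
  have : CompleteSpace S := (Submodule.isClosed_topologicalClosure _).completeSpace_coe
  have : TopologicalSpace.SeparableSpace S := by
    have h : TopologicalSpace.IsSeparable (S : Set H) :=
      ((countable_range x).isSeparable.span (R := ℝ)).closure
    exact h.separableSpace
  let g : ℕ → WeakDual ℝ S := fun n =>
    StrongDual.toWeakDual (InnerProductSpace.toDual ℝ S ⟨x n, hxS n⟩)
  have hg : ∀ n, g n ∈ WeakDual.toStrongDual ⁻¹' Metric.closedBall (0 : StrongDual ℝ S) M := by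
    intro n
    exact mem_closedBall_zero_iff.2 <|
      ((InnerProductSpace.toDual ℝ S).norm_map ⟨x n, hxS n⟩).trans_le (hx n)
  obtain ⟨ψ, -, φ, hφ, hlim⟩ := WeakDual.isSeqCompact_closedBall (𝕜 := ℝ) (E := S) 0 M hg
  let u : S := (InnerProductSpace.toDual ℝ S).symm (WeakDual.toStrongDual ψ)
  refine ⟨u, φ, hφ, fun a => ?_⟩
  have key := (tendsto_iff_forall_eval_tendsto_topDualPairing.1 hlim)
    (S.orthogonalProjectionOnto a)
  have hu : topDualPairing ℝ S ψ (S.orthogonalProjectionOnto a) = ⟪a, (u : H)⟫ := by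
    rw [← Submodule.inner_orthogonalProjectionOnto_eq_of_mem_right, real_inner_comm]
    exact (InnerProductSpace.toDual_symm_apply (𝕜 := ℝ)).symm
  rw [hu] at key
  refine key.congr fun n => ?_
  have h := Submodule.inner_orthogonalProjectionOnto_eq_of_mem_right (K := S)
    ⟨x (φ n), hxS (φ n)⟩ a
  rw [real_inner_comm] at h
  exact h

theorem abs_inner_apply_le {H : Type*} [NormedAddCommGroup H] [InnerProductSpace ℝ H]
    (T : H →L[ℝ] H) {x : H} {M : ℝ} (hx : ‖x‖ ≤ M) : |⟪x, T x⟫| ≤ M * (‖T‖ * M) :=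
  (abs_real_inner_le_norm _ _).trans <|
    mul_le_mul hx (T.le_opNorm_of_le hx) (norm_nonneg _) ((norm_nonneg _).trans hx)

theorem isBoundedUnder_inner_apply {H : Type*} [NormedAddCommGroup H] [InnerProductSpace ℝ H]
    (T : H →L[ℝ] H) {x : ℕ → H} {M : ℝ} (hx : ∀ n, ‖x n‖ ≤ M) :
    IsBoundedUnder (· ≤ ·) atTop (fun n => ⟪x n, T (x n)⟫) ∧
      IsBoundedUnder (· ≥ ·) atTop (fun n => ⟪x n, T (x n)⟫) :=
  ⟨isBoundedUnder_of ⟨_, fun n => (abs_le.1 (abs_inner_apply_le T (hx n))).2⟩,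
    isBoundedUnder_of ⟨_, fun n => (abs_le.1 (abs_inner_apply_le T (hx n))).1⟩⟩

theorem IsLegendreForm.inner_apply_le {H : Type*} [NormedAddCommGroup H]
    [InnerProductSpace ℝ H] {T : H →L[ℝ] H} (hT : IsLegendreForm T) {x : ℕ → H} {x₀ : H}
    (hx : WeaklyConvergesTo x x₀) {M : ℝ} (hM : ∀ n, ‖x n‖ ≤ M) {b : ℕ → ℝ} {β : ℝ}
    (hb : Tendsto b atTop (𝓝 β)) (hle : ∀ᶠ n in atTop, ⟪x n, T (x n)⟫ ≤ b n) :
    ⟪x₀, T x₀⟫ ≤ β :=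
  calc ⟪x₀, T x₀⟫ ≤ liminf (fun n => ⟪x n, T (x n)⟫) atTop := hT.1 x x₀ hx
    _ ≤ liminf b atTop := liminf_le_liminf hle (isBoundedUnder_inner_apply T hM).2
        hb.isBoundedUnder_le.isCoboundedUnder_ge
    _ = β := hb.liminf_eq

theorem IsLegendreForm.tendsto_of_inner_apply_le {H : Type*} [NormedAddCommGroup H]
    [InnerProductSpace ℝ H] {T : H →L[ℝ] H} (hT : IsLegendreForm T) {x : ℕ → H} {x₀ : H}
    (hx : WeaklyConvergesTo x x₀) {M : ℝ} (hM : ∀ n, ‖x n‖ ≤ M) {b : ℕ → ℝ}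
    (hb : Tendsto b atTop (𝓝 ⟪x₀, T x₀⟫)) (hle : ∀ᶠ n in atTop, ⟪x n, T (x n)⟫ ≤ b n) :
    Tendsto x atTop (𝓝 x₀) := by
  obtain ⟨hu, hl⟩ := isBoundedUnder_inner_apply T hM
  refine hT.2 x x₀ hx (tendsto_of_le_liminf_of_limsup_le (hT.1 x x₀ hx) ?_ hu hl)
  calc limsup (fun n => ⟪x n, T (x n)⟫) atTop ≤ limsup b atTop :=
        limsup_le_limsup hle hl.isCoboundedUnder_le hb.isBoundedUnder_le
    _ = _ := hb.limsup_eq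

theorem inner_apply_le_of_nonneg {H : Type*} [NormedAddCommGroup H]
    [InnerProductSpace ℝ H] {T : H →L[ℝ] H} (hsa : ∀ x y : H, ⟪T x, y⟫ = ⟪x, T y⟫)
    (hpos : ∀ x : H, 0 ≤ ⟪x, T x⟫) {x : ℕ → H} {x₀ : H} (hx : WeaklyConvergesTo x x₀)
    {b : ℕ → ℝ} {β : ℝ} (hb : Tendsto b atTop (𝓝 β))
    (hle : ∀ᶠ n in atTop, ⟪x n, T (x n)⟫ ≤ b n) : ⟪x₀, T x₀⟫ ≤ β := by
  have h := ((hx (T x₀)).const_mul 2).sub_const ⟪x₀, T x₀⟫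
  have := le_of_tendsto_of_tendsto h hb <| hle.mono fun n hn => by
    have h1 := hpos (x n - x₀)
    simp only [map_sub, inner_sub_left, inner_sub_right] at h1
    rw [← hsa x₀ (x n), real_inner_comm (T x₀) (x n)] at h1
    linarith
  rw [hsa] at this
  linarith

theorem apply_eq_zero_of_inner_apply_nonpos {H : Type*} [NormedAddCommGroup H]
    [InnerProductSpace ℝ H] {T : H →L[ℝ] H} (hsa : ∀ x y : H, ⟪T x, y⟫ = ⟪x, T y⟫)
    (hpos : ∀ x : H, 0 ≤ ⟪x, T x⟫) {v : H} (hv : ⟪v, T v⟫ ≤ 0) : T v = 0 := by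
  have h0 : ⟪v, T v⟫ = 0 := le_antisymm hv (hpos v)
  have hd := discrim_le_zero (a := ⟪v, T v⟫) (b := 2 * ⟪T v, T v⟫) (c := ⟪T v, T (T v)⟫) <| by
    intro t
    have h := hpos (T v + t • v)
    simp only [map_add, map_smul, inner_add_left, inner_add_right, inner_smul_left,
      inner_smul_right, conj_trivial] at h
    rw [← hsa v (T v)] at h
    linarith
  rw [discrim, h0] at hd
  have : ⟪T v, T v⟫ = 0 := by nlinarith
  exact inner_self_eq_zero.1 this

theorem quadratic_add_smul {H : Type*} [NormedAddCommGroup H] [InnerProductSpace ℝ H]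
    {T : H →L[ℝ] H} (hsa : ∀ x y : H, ⟪T x, y⟫ = ⟪x, T y⟫) (c x v : H) (t : ℝ) :
    (1/2 : ℝ) * ⟪x + t • v, T (x + t • v)⟫ + ⟪c, x + t • v⟫ =
      (1/2 : ℝ) * ⟪x, T x⟫ + ⟪c, x⟫ + t * (⟪x, T v⟫ + ⟪c, v⟫) + t ^ 2 * ((1/2) * ⟪v, T v⟫) := by
  simp only [map_add, map_smul, inner_add_left, inner_add_right, inner_smul_left,
    inner_smul_right, conj_trivial]
  rw [← hsa v x, real_inner_comm x (T v)]
  ring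

/-- A linear-quadratic function bounded below on a ray has a nonnegative leading coefficient,
and a nonnegative slope if the leading coefficient vanishes. -/
theorem coeff_nonneg_of_bddBelow_on_ray {a b d : ℝ}
    (h : ∀ t : ℝ, 0 ≤ t → d ≤ t * b + t ^ 2 * a) : 0 ≤ a ∧ (a = 0 → 0 ≤ b) := by
  constructor
  · by_contra! ha
    obtain ⟨t, ht⟩ := exists_gt (max 1 ((|b| + |d|) / -a))
    have h1 : 1 < t := (le_max_left _ _).trans_lt ht
    have h2 : |b| + |d| < t * -a := (div_lt_iff₀ (by linarith)).1 ((le_max_right _ _).trans_lt ht)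
    have := h t (by linarith)
    nlinarith [le_abs_self b, neg_abs_le d, abs_nonneg d]
  · rintro rfl
    by_contra! hb
    have h1 := h ((|d| + 1) / -b) (div_nonneg (by positivity) (by linarith))
    have h2 : (|d| + 1) / -b * b = -(|d| + 1) := by
      rw [div_mul_eq_mul_div, div_neg, mul_div_cancel_right₀ _ hb.ne]
    rw [h2] at h1
    linarith [neg_abs_le d]

/-- Existence of almost norm-minimal elements. -/
theorem Set.Nonempty.exists_sq_norm_le_add_one {H : Type*} [NormedAddCommGroup H] {S : Set H}
    (hS : S.Nonempty) : ∃ x ∈ S, ∀ y ∈ S, ‖x‖ ^ 2 ≤ ‖y‖ ^ 2 + 1 := by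
  have hb : BddBelow ((fun y : H => ‖y‖ ^ 2) '' S) := ⟨0, by rintro _ ⟨y, -, rfl⟩; positivity⟩
  obtain ⟨_, ⟨x, hx, rfl⟩, hlt⟩ := exists_lt_of_csInf_lt (hS.image fun y : H => ‖y‖ ^ 2)
    (lt_add_one (sInf ((fun y : H => ‖y‖ ^ 2) '' S)))
  refine ⟨x, hx, fun y hy => ?_⟩
  linarith [csInf_le hb (Set.mem_image_of_mem _ hy)]

/-- Almost norm-minimal elements of the sublevel sets of `f` on `F` cannot escape to infinity:
otherwise a weak limit `v` of their normalizations is a direction along which they may be moved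
back inside `F` without increasing `f`. -/
theorem false_of_escaping_direction
    {H : Type*} [NormedAddCommGroup H] [InnerProductSpace ℝ H]
    {ι : Type*} [Finite ι] {T : H →L[ℝ] H} (hT_sa : ∀ x y : H, ⟪T x, y⟫ = ⟪x, T y⟫) (c : H)
    {Ti : ι → H →L[ℝ] H}
    (hTi_sa : ∀ i, ∀ x y : H, ⟪Ti i x, y⟫ = ⟪x, Ti i y⟫)
    (hTi_pos : ∀ i, ∀ x : H, 0 ≤ ⟪x, Ti i x⟫)
    (ci : ι → H) (α : ι → ℝ)
    {f : H → ℝ} (hf : ∀ x, f x = (1/2 : ℝ) * ⟪x, T x⟫ + ⟪c, x⟫)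
    {F : Set H}
    (hmem : ∀ x, x ∈ F ↔ ∀ i, (1/2 : ℝ) * ⟪x, Ti i x⟫ + ⟪ci i, x⟫ + α i ≤ 0)
    (hLeg : IsLegendreForm T) (hc : ∀ i, Ti i ≠ 0 → ci i = 0)
    {μ : ℝ} (hlb : ∀ x ∈ F, μ ≤ f x) {e : ℕ → ℝ} {β : ℝ} (he : Tendsto e atTop (𝓝 β))
    {x : ℕ → H} (hxF : ∀ n, x n ∈ F) (hxe : ∀ n, f (x n) ≤ e n)
    (hxmin : ∀ n, ∀ y ∈ F, f y ≤ f (x n) → ‖x n‖ ^ 2 ≤ ‖y‖ ^ 2 + 1)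
    (hunb : Tendsto (fun n => ‖x n‖) atTop atTop) {v : H}
    (hv : WeaklyConvergesTo (fun n => ‖x n‖⁻¹ • x n) v) : False := by
  have hpos : ∀ᶠ n in atTop, 0 < ‖x n‖ := hunb.eventually_gt_atTop 0
  have hinv : Tendsto (fun n => ‖x n‖⁻¹) atTop (𝓝 0) := tendsto_inv_atTop_zero.comp hunb
  have hle1 : ∀ n, ‖‖x n‖⁻¹ • x n‖ ≤ 1 := fun n => by
    rw [norm_smul, norm_inv, norm_norm]
    exact inv_mul_le_one
  have hform : ∀ (A : H →L[ℝ] H) (n : ℕ),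
      ⟪‖x n‖⁻¹ • x n, A (‖x n‖⁻¹ • x n)⟫ = ‖x n‖⁻¹ ^ 2 * ⟪x n, A (x n)⟫ := fun A n => by
    simp only [map_smul, inner_smul_left, inner_smul_right, conj_trivial]
    ring
  -- `v` is a recession direction of `F`
  have hTiv : ∀ i, Ti i v = 0 := fun i => by
    have hb := ((hinv.mul (hv (ci i))).add ((hinv.pow 2).mul_const (α i))).const_mul (-2)
    refine apply_eq_zero_of_inner_apply_nonpos (hTi_sa i) (hTi_pos i) <|
      (inner_apply_le_of_nonneg (hTi_sa i) (hTi_pos i) hv hb <| .of_forall fun n => ?_).trans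
        (by simp)
    have h := mul_le_mul_of_nonneg_left ((hmem _).1 (hxF n) i) (sq_nonneg ‖x n‖⁻¹)
    rw [hform, inner_smul_right]
    linarith
  have hciv : ∀ i, ⟪ci i, v⟫ ≤ 0 := fun i => by
    refine le_of_tendsto_of_tendsto (hv (ci i)) (hinv.mul_const (-α i)) (.of_forall fun n => ?_)
      |>.trans (by simp)
    have h := mul_le_mul_of_nonneg_left ((hmem _).1 (hxF n) i) (inv_nonneg.2 (norm_nonneg (x n)))
    have h2 := mul_nonneg (inv_nonneg.2 (norm_nonneg (x n))) (hTi_pos i (x n))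
    simp only [inner_smul_right]
    linarith
  have hg : ∀ i y (t : ℝ), (1/2 : ℝ) * ⟪y + t • v, Ti i (y + t • v)⟫ + ⟪ci i, y + t • v⟫ =
      (1/2 : ℝ) * ⟪y, Ti i y⟫ + ⟪ci i, y⟫ + t * ⟪ci i, v⟫ := fun i y t => by
    rw [quadratic_add_smul (hTi_sa i), hTiv i]
    simp
  -- the form `T` vanishes at `v`
  have hb : Tendsto (fun n => 2 * (‖x n‖⁻¹ ^ 2 * e n - ‖x n‖⁻¹ * ⟪c, ‖x n‖⁻¹ • x n⟫))
      atTop (𝓝 0) := by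
    simpa using (((hinv.pow 2).mul he).sub (hinv.mul (hv c))).const_mul 2
  have hTb : ∀ n, ⟪‖x n‖⁻¹ • x n, T (‖x n‖⁻¹ • x n)⟫ ≤
      2 * (‖x n‖⁻¹ ^ 2 * e n - ‖x n‖⁻¹ * ⟪c, ‖x n‖⁻¹ • x n⟫) := fun n => by
    have h := mul_le_mul_of_nonneg_left (hxe n) (sq_nonneg ‖x n‖⁻¹)
    rw [hf] at h
    rw [hform, inner_smul_right]
    linarith
  have hray : ∀ y ∈ F, 0 ≤ (1/2) * ⟪v, T v⟫ ∧ ((1/2) * ⟪v, T v⟫ = 0 → 0 ≤ ⟪y, T v⟫ + ⟪c, v⟫) :=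
    fun y hy => coeff_nonneg_of_bddBelow_on_ray (d := μ - f y) fun t ht => by
      have hF : y + t • v ∈ F := (hmem _).2 fun i => by
        rw [hg]
        linarith [(hmem _).1 hy i, mul_nonpos_of_nonneg_of_nonpos ht (hciv i)]
      have h := hlb _ hF
      rw [hf, quadratic_add_smul hT_sa, ← hf] at h
      linarith
  have hTv : ⟪v, T v⟫ = 0 := le_antisymm
    (hLeg.inner_apply_le hv hle1 hb (.of_forall hTb)) (by linarith [(hray _ (hxF 0)).1])
  have hv0 : v ≠ 0 := by
    rintro rfl
    have h := (hLeg.tendsto_of_inner_apply_le hv hle1 (by rwa [hTv]) (.of_forall hTb)).norm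
    have h1 : Tendsto (fun n => ‖‖x n‖⁻¹ • x n‖) atTop (𝓝 1) :=
      tendsto_const_nhds.congr' <| hpos.mono fun n hn => by
        dsimp only
        rw [norm_smul, norm_inv, norm_norm, inv_mul_cancel₀ hn.ne']
    simpa using tendsto_nhds_unique h h1
  -- moving `x n` by `-v` stays in `F`, does not increase `f`, and shrinks the norm
  have hscale : ∀ a, ∀ᶠ n in atTop, ‖x n‖ * ⟪a, ‖x n‖⁻¹ • x n⟫ = ⟪a, x n⟫ := fun a =>
    hpos.mono fun n hn => by rw [inner_smul_right, mul_inv_cancel_left₀ hn.ne']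
  have hstay : ∀ i, ∀ᶠ n in atTop,
      (1/2 : ℝ) * ⟪x n, Ti i (x n)⟫ + ⟪ci i, x n⟫ + (-1) * ⟪ci i, v⟫ + α i ≤ 0 := fun i => by
    rcases (hciv i).eq_or_lt with h0 | hlt
    · refine .of_forall fun n => ?_
      rw [h0]
      linarith [(hmem _).1 (hxF n) i]
    · have hTi0 : Ti i = 0 := by
        by_contra h
        simp [hc i h] at hlt
      have h := (hunb.atTop_mul_neg hlt (hv (ci i))).congr' (hscale (ci i))
      filter_upwards [h.eventually_le_atBot (⟪ci i, v⟫ - α i)] with n hn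
      simp only [hTi0, zero_apply, inner_zero_right]
      linarith
  have hvpos : 0 < ⟪v, v⟫ := real_inner_self_pos.2 hv0
  have hshrink := (hunb.atTop_mul_pos hvpos (hv v)).congr' (hscale v)
  obtain ⟨n, hn, hn'⟩ := ((eventually_all.2 hstay).and
    (hshrink.eventually_gt_atTop ((1 + ⟪v, v⟫) / 2))).exists
  have hF : x n + (-1 : ℝ) • v ∈ F := (hmem _).2 fun i => by
    rw [hg]
    exact hn i
  have hle : f (x n + (-1 : ℝ) • v) ≤ f (x n) := by
    rw [hf, quadratic_add_smul hT_sa, ← hf, hTv]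
    linarith [(hray _ (hxF n)).2 (by rw [hTv, mul_zero])]
  have h := hxmin n _ hF hle
  rw [neg_one_smul, ← sub_eq_add_neg, norm_sub_sq_real, ← real_inner_self_eq_norm_sq v,
    real_inner_comm] at h
  linarith

/-- If `⟪x, T x⟫` is a Legendre form, `cᵢ = 0` whenever `Tᵢ ≠ 0`, `F` is nonempty and `f` is
bounded from below on `F`, then `f` attains its infimum on `F`. -/
theorem frank_wolfe_ci_zero
    {H : Type*} [NormedAddCommGroup H] [InnerProductSpace ℝ H] [CompleteSpace H]
    {m : ℕ} (T : H →L[ℝ] H) (hT_sa : ∀ x y : H, ⟪T x, y⟫ = ⟪x, T y⟫) (c : H)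
    (Ti : Fin m → H →L[ℝ] H)
    (hTi_sa : ∀ i, ∀ x y : H, ⟪Ti i x, y⟫ = ⟪x, Ti i y⟫)
    (hTi_pos : ∀ i, ∀ x : H, 0 ≤ ⟪x, Ti i x⟫)
    (ci : Fin m → H) (α : Fin m → ℝ)
    (f : H → ℝ) (hf : ∀ x, f x = (1/2 : ℝ) * ⟪x, T x⟫ + ⟪c, x⟫)
    (F : Set H)
    (hF : F = {x : H | ∀ i, (1/2 : ℝ) * ⟪x, Ti i x⟫ + ⟪ci i, x⟫ + α i ≤ 0})
    (hLeg : IsLegendreForm T)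
    (hc : ∀ i, Ti i ≠ 0 → ci i = 0)
    (hne : F.Nonempty) (hbd : BddBelow (f '' F)) :
    ∃ xbar ∈ F, ∀ x ∈ F, f xbar ≤ f x := by
  have hmem : ∀ x, x ∈ F ↔ ∀ i, (1/2 : ℝ) * ⟪x, Ti i x⟫ + ⟪ci i, x⟫ + α i ≤ 0 := by
    intro x; rw [hF]; rfl
  obtain ⟨e, he, hlb, hsel⟩ : ∃ e : ℕ → ℝ, Tendsto e atTop (𝓝 (sInf (f '' F))) ∧
      (∀ x ∈ F, sInf (f '' F) ≤ f x) ∧ ∀ n, ∃ x ∈ F, f x ≤ e n ∧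
        ∀ y ∈ F, f y ≤ f x → ‖x‖ ^ 2 ≤ ‖y‖ ^ 2 + 1 := by
    refine ⟨fun n => sInf (f '' F) + 1 / ((n : ℝ) + 1), ?_, fun x hx =>
      csInf_le hbd (Set.mem_image_of_mem f hx), fun n => ?_⟩
    · simpa using tendsto_one_div_add_atTop_nhds_zero_nat.const_add (sInf (f '' F))
    · obtain ⟨_, ⟨z, hz, rfl⟩, hlt⟩ := exists_lt_of_csInf_lt (hne.image f)
        (lt_add_of_pos_right (sInf (f '' F)) (Nat.one_div_pos_of_nat (α := ℝ) (n := n)))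
      obtain ⟨x, ⟨hxF, hxe⟩, hx⟩ := Set.Nonempty.exists_sq_norm_le_add_one
        (S := {y | y ∈ F ∧ f y ≤ sInf (f '' F) + 1 / ((n : ℝ) + 1)}) ⟨z, hz, hlt.le⟩
      exact ⟨x, hxF, hxe, fun y hy hyx => hx y ⟨hy, hyx.trans hxe⟩⟩
  choose x hxF hxe hxmin using hsel
  by_cases hunb : Tendsto (fun n => ‖x n‖) atTop atTop
  · exfalso
    obtain ⟨v, φ, hφ, hv⟩ := exists_subseq_weaklyConvergesTo (x := fun n => ‖x n‖⁻¹ • x n)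
      (M := 1) fun n => by
        rw [norm_smul, norm_inv, norm_norm]
        exact inv_mul_le_one
    exact false_of_escaping_direction hT_sa c hTi_sa hTi_pos ci α hf hmem hLeg hc hlb
      (he.comp hφ.tendsto_atTop) (fun n => hxF (φ n)) (fun n => hxe (φ n))
      (fun n => hxmin (φ n)) (hunb.comp hφ.tendsto_atTop) hv
  · obtain ⟨M, hM⟩ : ∃ M, ∃ᶠ n in atTop, ‖x n‖ ≤ M := by
      simp only [tendsto_atTop, not_forall, not_eventually, not_le] at hunb
      exact hunb.imp fun M h => h.mono fun n hn => hn.le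
    obtain ⟨ψ, hψ, hψM⟩ := extraction_of_frequently_atTop hM
    obtain ⟨x₀, φ, hφ, hx₀⟩ := exists_subseq_weaklyConvergesTo (x := x ∘ ψ) hψM
    refine ⟨x₀, (hmem x₀).2 fun i => ?_, fun y hy => le_trans ?_ (hlb y hy)⟩
    · have hb := ((hx₀ (ci i)).add_const (α i)).const_mul (-2)
      have := inner_apply_le_of_nonneg (hTi_sa i) (hTi_pos i) hx₀ hb <| .of_forall fun n => by
        have := (hmem _).1 (hxF (ψ (φ n))) i
        simp only [Function.comp_apply]
        linarith
      linarith
    · have hb := ((he.comp (hψ.comp hφ).tendsto_atTop).sub (hx₀ c)).const_mul 2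
      have := hLeg.inner_apply_le hx₀ (fun n => hψM (φ n)) hb <| .of_forall fun n => by
        have := hxe (ψ (φ n))
        rw [hf] at this
        simp only [Function.comp_apply]
        linarith
      rw [hf]
      linarith
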